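/- arXiv:1911.02758 — 2 statements merged into one kernel-verified Lean document; each statement's English description precedes it below -/
import Mathlib

section
/- Let X be a second-countable T₀ topological space. Then for every α < ω₁ the Borel class Σ⁰_{2+α}(X) has the σ-reduction property. If X is moreover zero-dimensional (has a basis of clopen sets), then Σ⁰_{1+α}(X) has the σ-reduction property for every α < ω₁; in particular the collection Σ⁰₁(X) of open sets has it. -/
open Set

namespace IFHpaper

noncomputable section

/-- The first uncountable ordinal. -/
def w1 : Ordinal.{0} := (Cardinal.aleph 1).ord

/-- A tree: a nonempty, prefix-closed set of finite sequences of naturals. -/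
def IsTree (T : Set (List ℕ)) : Prop :=
  T.Nonempty ∧ ∀ σ τ : List ℕ, σ <+: τ → τ ∈ T → σ ∈ T

/-- A well-founded tree: a tree with no infinite path. -/
def IsWFTree (T : Set (List ℕ)) : Prop :=
  IsTree T ∧ ∀ x : ℕ → ℕ, ∃ n : ℕ, (List.range n).map x ∉ T

/-- The proper extensions of `τ` lying in `T`. -/
def properExt (T : Set (List ℕ)) (τ : List ℕ) : Set (List ℕ) :=
  {τ' | τ' ∈ T ∧ τ <+: τ' ∧ τ ≠ τ'}

/-- The component of a `T`-family at node `τ`:  `U τ` minus the union of the sets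
attached to proper extensions of `τ` in `T`. -/
def component {X : Type} (T : Set (List ℕ)) (U : List ℕ → Set X) (τ : List ℕ) : Set X :=
  U τ \ ⋃ τ' ∈ properExt T τ, U τ'

/-- A `T`-family is monotone if `U τ ⊇ U τ'` whenever `τ ⊑ τ'` in `T`. -/
def MonotoneFam {X : Type} (T : Set (List ℕ)) (U : List ℕ → Set X) : Prop :=
  ∀ τ ∈ T, ∀ τ' ∈ T, τ <+: τ' → U τ' ⊆ U τ

/-- A reduced `T`-family: monotone, with disjoint sets at distinct one-step extensions. -/
def ReducedFam {X : Type} (T : Set (List ℕ)) (U : List ℕ → Set X) : Prop :=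
  MonotoneFam T U ∧
    ∀ (τ : List ℕ) (i j : ℕ), τ ++ [i] ∈ T → τ ++ [j] ∈ T → i ≠ j →
      U (τ ++ [i]) ∩ U (τ ++ [j]) = ∅

/-- An infinite-branching tree: every non-leaf node has all its one-step extensions in `T`. -/
def InfBranching (T : Set (List ℕ)) : Prop :=
  ∀ τ ∈ T, (∃ τ' ∈ T, τ <+: τ' ∧ τ ≠ τ') → ∀ i : ℕ, τ ++ [i] ∈ T

/-- The σ-reduction property for a collection of sets. -/
def SigmaReduction {X : Type} (𝒜 : Set (Set X)) : Prop :=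
  ∀ C : ℕ → Set X, (∀ i, C i ∈ 𝒜) →
    ∃ C' : ℕ → Set X, (∀ i, C' i ∈ 𝒜) ∧ (∀ i, C' i ⊆ C i) ∧
      (∀ i j, i ≠ j → C' i ∩ C' j = ∅) ∧ (⋃ i, C' i) = ⋃ i, C i

/-- A (hierarchy) base in a set `X`: an `ω₁`-indexed family of collections of subsets of `X`,
each closed under countable unions and finite intersections, and increasing in the
appropriate sense. -/
structure IsBase {X : Type} (L : Ordinal.{0} → Set (Set X)) : Prop where
  iUnion_mem : ∀ α < w1, ∀ f : ℕ → Set X, (∀ n, f n ∈ L α) → (⋃ n, f n) ∈ L α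
  inter_mem : ∀ α < w1, ∀ A B : Set X, A ∈ L α → B ∈ L α → A ∩ B ∈ L α
  empty_mem : ∀ α < w1, (∅ : Set X) ∈ L α
  univ_mem : ∀ α < w1, (univ : Set X) ∈ L α
  mono : ∀ α β : Ordinal.{0}, α < β → β < w1 → ∀ A : Set X, A ∈ L α → A ∈ L β ∧ Aᶜ ∈ L β

/-- The `β`-shift of a base: level `α` of the shift is level `β + α` of `L`. -/
def shiftL {X : Type} (L : Ordinal.{0} → Set (Set X)) (β : Ordinal.{0}) :
    Ordinal.{0} → Set (Set X) := fun α => L (β + α)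

/-- The `V`-restriction of a base: level `α` consists of the sets `V ∩ S`, `S ∈ L α`. -/
def restrictL {X : Type} (L : Ordinal.{0} → Set (Set X)) (V : Set X) :
    Ordinal.{0} → Set (Set X) := fun α => {W | ∃ S ∈ L α, W = V ∩ S}

open Classical in
/-- The Borel hierarchy `Σ⁰_α(X)` (defined for `1 ≤ α`): `Σ⁰₁` is the open sets, `Σ⁰₂` the
countable unions of differences of open sets, and for `α > 2`, `Σ⁰_α` consists of the
countable unions of complements of sets in lower levels `Σ⁰_β`, `1 ≤ β < α`. -/
def SigmaO (X : Type) [TopologicalSpace X] (α : Ordinal.{0}) : Set (Set X) :=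
  if α = 1 then {U : Set X | IsOpen U}
  else if α = 2 then
    {A : Set X | ∃ U V : ℕ → Set X, (∀ n, IsOpen (U n)) ∧ (∀ n, IsOpen (V n)) ∧
      A = ⋃ n, U n \ V n}
  else
    {A : Set X | ∃ S : ℕ → Set X,
      (∀ n, ∃ β : Ordinal.{0}, ∃ _ : β < α, 1 ≤ β ∧ S n ∈ SigmaO X β) ∧ A = ⋃ n, (S n)ᶜ}
termination_by α
decreasing_by assumption

/-- The Borel base of a topological space: level `α` is `Σ⁰_{1+α}(X)`. -/
def borelBase (X : Type) [TopologicalSpace X] : Ordinal.{0} → Set (Set X) :=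
  fun α => SigmaO X (1 + α)

/-- The existential category quantifier `f[A]`:  the set of `y` such that `A ∩ f⁻¹(y)` is
non-meager in the subspace `f⁻¹(y)`. -/
def catIm {X Y : Type} [TopologicalSpace X] (f : X → Y) (A : Set X) : Set Y :=
  {y | ¬ IsMeagre ((Subtype.val : (f ⁻¹' {y} : Set X) → X) ⁻¹' A)}

/-- A space is zero-dimensional if it has a basis of clopen sets. -/
def ZeroDim (X : Type) [TopologicalSpace X] : Prop :=
  ∀ (x : X) (U : Set X), IsOpen U → x ∈ U → ∃ V : Set X, IsClopen V ∧ x ∈ V ∧ V ⊆ U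

/-- Countable ordinals. -/
abbrev CtbOrd : Type 1 := {α : Ordinal.{0} // α < w1}

/-- Terms over a quasiorder `Q`: constants `q ∈ Q`, unary `s_α`, and `ω`-ary `F_q`, `F_α`
(`α` a countable ordinal). -/
inductive Term (Q : Type) : Type 1 where
  | const : Q → Term Q
  | s : CtbOrd → Term Q → Term Q
  | Fc : Q → (ℕ → Term Q) → Term Q
  | Fo : CtbOrd → (ℕ → Term Q) → Term Q

/-- The relation `⊴` on terms. -/
inductive TLE {Q : Type} [Preorder Q] : Term Q → Term Q → Prop where
  | const_const {q r : Q} : q ≤ r → TLE (.const q) (.const r)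
  | const_s {q : Q} {a : CtbOrd} {u : Term Q} :
      TLE (.const q) u → TLE (.const q) (.s a u)
  | const_Fc_left {q r : Q} {vs : ℕ → Term Q} :
      TLE (.const q) (.const r) → TLE (.const q) (.Fc r vs)
  | const_Fc_right {q r : Q} {vs : ℕ → Term Q} (i : ℕ) :
      TLE (.const q) (vs i) → TLE (.const q) (.Fc r vs)
  | const_Fo {q : Q} {b : CtbOrd} {vs : ℕ → Term Q} (i : ℕ) :
      TLE (.const q) (vs i) → TLE (.const q) (.Fo b vs)
  | s_const {a : CtbOrd} {u : Term Q} {r : Q} :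
      TLE u (.const r) → TLE (.s a u) (.const r)
  | s_s_lt {a b : CtbOrd} {u v : Term Q} :
      a.1 < b.1 → TLE u (.s b v) → TLE (.s a u) (.s b v)
  | s_s_eq {a : CtbOrd} {u v : Term Q} :
      TLE u v → TLE (.s a u) (.s a v)
  | s_s_gt {a b : CtbOrd} {u v : Term Q} :
      b.1 < a.1 → TLE (.s a u) v → TLE (.s a u) (.s b v)
  | s_Fc_left {a : CtbOrd} {u : Term Q} {r : Q} {vs : ℕ → Term Q} :
      TLE (.s a u) (.const r) → TLE (.s a u) (.Fc r vs)
  | s_Fc_right {a : CtbOrd} {u : Term Q} {r : Q} {vs : ℕ → Term Q} (i : ℕ) :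
      TLE (.s a u) (vs i) → TLE (.s a u) (.Fc r vs)
  | s_Fo_left {a : CtbOrd} {u : Term Q} {b : CtbOrd} {vs : ℕ → Term Q} :
      TLE (.s a u) (.s b (vs 0)) → TLE (.s a u) (.Fo b vs)
  | s_Fo_right {a : CtbOrd} {u : Term Q} {b : CtbOrd} {vs : ℕ → Term Q} (i : ℕ) :
      TLE (.s a u) (vs (i + 1)) → TLE (.s a u) (.Fo b vs)
  | Fc_const {q : Q} {us : ℕ → Term Q} {r : Q} :
      TLE (.const q) (.const r) → (∀ i, TLE (us i) (.const r)) →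
      TLE (.Fc q us) (.const r)
  | Fc_s {q : Q} {us : ℕ → Term Q} {b : CtbOrd} {v : Term Q} :
      TLE (.const q) (.s b v) → (∀ i, TLE (us i) (.s b v)) →
      TLE (.Fc q us) (.s b v)
  | Fc_Fc_left {q : Q} {us : ℕ → Term Q} {r : Q} {vs : ℕ → Term Q} :
      TLE (.const q) (.const r) → (∀ i, TLE (us i) (.Fc r vs)) →
      TLE (.Fc q us) (.Fc r vs)
  | Fc_Fc_right {q : Q} {us : ℕ → Term Q} {r : Q} {vs : ℕ → Term Q} (i : ℕ) :
      TLE (.Fc q us) (vs i) → TLE (.Fc q us) (.Fc r vs)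
  | Fc_Fo_left {q : Q} {us : ℕ → Term Q} {b : CtbOrd} {vs : ℕ → Term Q} :
      TLE (.const q) (.s b (vs 0)) → (∀ i, TLE (us i) (.Fo b vs)) →
      TLE (.Fc q us) (.Fo b vs)
  | Fc_Fo_right {q : Q} {us : ℕ → Term Q} {b : CtbOrd} {vs : ℕ → Term Q} (i : ℕ) :
      TLE (.Fc q us) (vs (i + 1)) → TLE (.Fc q us) (.Fo b vs)
  | Fo_const {a : CtbOrd} {us : ℕ → Term Q} {r : Q} :
      TLE (.s a (us 0)) (.const r) → (∀ i, TLE (us (i + 1)) (.const r)) →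
      TLE (.Fo a us) (.const r)
  | Fo_s {a : CtbOrd} {us : ℕ → Term Q} {b : CtbOrd} {v : Term Q} :
      TLE (.s a (us 0)) (.s b v) → (∀ i, TLE (us (i + 1)) (.s b v)) →
      TLE (.Fo a us) (.s b v)
  | Fo_Fc_left {a : CtbOrd} {us : ℕ → Term Q} {r : Q} {vs : ℕ → Term Q} :
      TLE (.s a (us 0)) (.const r) → (∀ i, TLE (us (i + 1)) (.Fc r vs)) →
      TLE (.Fo a us) (.Fc r vs)
  | Fo_Fc_right {a : CtbOrd} {us : ℕ → Term Q} {r : Q} {vs : ℕ → Term Q} (i : ℕ) :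
      TLE (.Fo a us) (vs i) → TLE (.Fo a us) (.Fc r vs)
  | Fo_Fo_left {a : CtbOrd} {us : ℕ → Term Q} {b : CtbOrd} {vs : ℕ → Term Q} :
      TLE (.s a (us 0)) (.s b (vs 0)) → (∀ i, TLE (us (i + 1)) (.Fo b vs)) →
      TLE (.Fo a us) (.Fo b vs)
  | Fo_Fo_right {a : CtbOrd} {us : ℕ → Term Q} {b : CtbOrd} {vs : ℕ → Term Q} (i : ℕ) :
      TLE (.Fo a us) (vs (i + 1)) → TLE (.Fo a us) (.Fo b vs)

/-- `u`-families over a base `L`, on a domain (ambient set) `D ⊆ X`, defined by recursion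
on the term `u` following the labeled tree `T(u)`:
* a `q`-family is trivial;
* an `s_α(u)`-family is a `u`-family over the `ω^α`-shift of the base;
* an `F_q(u₀,…)`-family consists of a monotone `T(u)`-family of level-`0` sets of the base
  restricted to the current domain (encoded via the child sets `U i ∈ 𝓛₀(D)` together with,
  recursively, the `uᵢ`-families on the `U i`, which carry the deeper tree sets);
* an `F_α(u₀,…)`-family additionally carries the `s_α(u₀)`-family attached to the root,
  living on the component `D \ ⋃ᵢ U i` of the root. -/
inductive Fam {X Q : Type} : Term Q → (Ordinal.{0} → Set (Set X)) → Set X → Type 1 where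
  | const (q : Q) (L : Ordinal.{0} → Set (Set X)) (D : Set X) : Fam (.const q) L D
  | s (a : CtbOrd) (u : Term Q) (L : Ordinal.{0} → Set (Set X)) (D : Set X) :
      Fam u (shiftL L (Ordinal.omega0 ^ a.1)) D → Fam (.s a u) L D
  | Fc (q : Q) (us : ℕ → Term Q) (L : Ordinal.{0} → Set (Set X)) (D : Set X)
      (U : ℕ → Set X) (hU : ∀ i, U i ∈ restrictL L D 0)
      (fams : ∀ i, Fam (us i) L (U i)) : Fam (.Fc q us) L D
  | Fo (a : CtbOrd) (us : ℕ → Term Q) (L : Ordinal.{0} → Set (Set X)) (D : Set X)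
      (U : ℕ → Set X) (hU : ∀ i, U i ∈ restrictL L D 0)
      (F0 : Fam (us 0) (shiftL L (Ordinal.omega0 ^ a.1)) (D \ ⋃ i, U i))
      (fams : ∀ i, Fam (us (i + 1)) L (U i)) : Fam (.Fo a us) L D

/-- The relation "the `u`-family `F` (on domain `D`) determines the `Q`-partition `A`". -/
def Determines {X Q : Type} : (u : Term Q) → (L : Ordinal.{0} → Set (Set X)) → (D : Set X) →
    Fam u L D → (X → Q) → Prop
  | _, _, _, .const q _ D, A => ∀ x ∈ D, A x = q
  | _, _, _, .s a u L D F, A => Determines u (shiftL L (Ordinal.omega0 ^ a.1)) D F A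
  | _, _, _, .Fc q us L D U _ fams, A =>
      (∀ x ∈ D \ ⋃ i, U i, A x = q) ∧ ∀ i, Determines (us i) L (U i) (fams i) A
  | _, _, _, .Fo a us L D U _ F0 fams, A =>
      Determines (us 0) (shiftL L (Ordinal.omega0 ^ a.1)) (D \ ⋃ i, U i) F0 A ∧
        ∀ i, Determines (us (i + 1)) L (U i) (fams i) A

/-- A `u`-family is reduced if all monotone tree families occurring in it are reduced
(sets at distinct siblings are disjoint), recursively. -/
def FamReduced {X Q : Type} : (u : Term Q) → (L : Ordinal.{0} → Set (Set X)) → (D : Set X) →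
    Fam u L D → Prop
  | _, _, _, .const _ _ _ => True
  | _, _, _, .s a u L D F => FamReduced u (shiftL L (Ordinal.omega0 ^ a.1)) D F
  | _, _, _, .Fc _ us L _ U _ fams =>
      (∀ i j, i ≠ j → U i ∩ U j = ∅) ∧ ∀ i, FamReduced (us i) L (U i) (fams i)
  | _, _, _, .Fo a us L D U _ F0 fams =>
      (∀ i j, i ≠ j → U i ∩ U j = ∅) ∧
        FamReduced (us 0) (shiftL L (Ordinal.omega0 ^ a.1)) (D \ ⋃ i, U i) F0 ∧
        ∀ i, FamReduced (us (i + 1)) L (U i) (fams i)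

/-- The level `𝓛(D,u)` of the infinitary fine hierarchy over the base `L` restricted to the
domain `D`: the `Q`-partitions determined by some `u`-family on `D`. -/
def levelOn {X : Type} (Q : Type) (L : Ordinal.{0} → Set (Set X)) (D : Set X) (u : Term Q) :
    Set (X → Q) :=
  {A | ∃ F : Fam u L D, Determines u L D F A}

/-- The level `𝓛(X,u)` of the infinitary fine hierarchy over the base `L`. -/
def level {X : Type} (Q : Type) (L : Ordinal.{0} → Set (Set X)) (u : Term Q) : Set (X → Q) :=
  levelOn Q L Set.univ u

/-- `red-𝓛(X,u)`: the `Q`-partitions determined by some reduced `u`-family. -/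
def levelRed {X : Type} (Q : Type) (L : Ordinal.{0} → Set (Set X)) (u : Term Q) :
    Set (X → Q) :=
  {A | ∃ F : Fam u L Set.univ, FamReduced u L Set.univ F ∧ Determines u L Set.univ F A}

/-- Wadge reducibility of `Q`-partitions of a space `X`. -/
def WadgeLe {X : Type} [TopologicalSpace X] {Q : Type} [Preorder Q] (A B : X → Q) : Prop :=
  ∃ f : X → X, Continuous f ∧ ∀ x, A x ≤ B (f x)

/-- The downward Wadge closure `𝓛̂(X,u)` of the level `𝓛(X,u)`. -/
def levelHat {X : Type} [TopologicalSpace X] (Q : Type) [Preorder Q]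
    (L : Ordinal.{0} → Set (Set X)) (u : Term Q) : Set (X → Q) :=
  {A | ∃ B ∈ level Q L u, WadgeLe A B}


/-- The countable unions of members of `ℬ`. -/
def countableUnions {X : Type} (ℬ : Set (Set X)) : Set (Set X) :=
  {A | ∃ D : ℕ → Set X, (∀ n, D n ∈ ℬ) ∧ A = ⋃ n, D n}

theorem mem_countableUnions_of_mem {X : Type} {ℬ : Set (Set X)} {A : Set X} (hA : A ∈ ℬ) :
    A ∈ countableUnions ℬ :=
  ⟨fun _ => A, fun _ => hA, (iUnion_const A).symm⟩

theorem iUnion_mem_countableUnions {X : Type} {ℬ : Set (Set X)} {f : ℕ → Set X}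
    (hf : ∀ n, f n ∈ countableUnions ℬ) : (⋃ n, f n) ∈ countableUnions ℬ := by
  choose D hD hfD using hf
  refine ⟨fun k => D k.unpair.1 k.unpair.2, fun k => hD _ _, ?_⟩
  rw [iUnion_unpair]
  exact iUnion_congr hfD

theorem union_mem_countableUnions {X : Type} {ℬ : Set (Set X)} {A B : Set X}
    (hA : A ∈ countableUnions ℬ) (hB : B ∈ countableUnions ℬ) :
    A ∪ B ∈ countableUnions ℬ := by
  have h : A ∪ B = ⋃ n : ℕ, if n = 0 then A else B := by
    ext x
    simp only [mem_union, mem_iUnion]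
    refine ⟨?_, ?_⟩
    · rintro (h | h)
      · exact ⟨0, by simpa using h⟩
      · exact ⟨1, by simpa using h⟩
    · rintro ⟨n, hn⟩
      split_ifs at hn
      · exact Or.inl hn
      · exact Or.inr hn
  rw [h]
  refine iUnion_mem_countableUnions fun n => ?_
  split_ifs
  · exact hA
  · exact hB

theorem inter_mem_countableUnions {X : Type} {ℬ : Set (Set X)}
    (hinter : ∀ A ∈ ℬ, ∀ B ∈ ℬ, A ∩ B ∈ ℬ) {A B : Set X}
    (hA : A ∈ countableUnions ℬ) (hB : B ∈ countableUnions ℬ) :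
    A ∩ B ∈ countableUnions ℬ := by
  obtain ⟨D, hD, rfl⟩ := hA
  obtain ⟨E, hE, rfl⟩ := hB
  rw [iUnion_inter]
  refine iUnion_mem_countableUnions fun n => ⟨fun m => D n ∩ E m, fun m => ?_, ?_⟩
  · exact hinter _ (hD n) _ (hE m)
  · rw [inter_iUnion]

theorem sigmaReduction_countableUnions {X : Type} {ℬ : Set (Set X)}
    (hinter : ∀ A ∈ ℬ, ∀ B ∈ ℬ, A ∩ B ∈ ℬ) (hcompl : ∀ A ∈ ℬ, Aᶜ ∈ countableUnions ℬ) :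
    SigmaReduction (countableUnions ℬ) := by
  intro C hC
  choose D hD hCD using hC
  let f : ℕ → Set X := fun k => D k.unpair.1 k.unpair.2
  have hf : ∀ k, f k ∈ ℬ := fun k => hD _ _
  have hdisj : ∀ k, disjointed f k ∈ countableUnions ℬ := fun k => by
    refine disjointedRec (p := (· ∈ countableUnions ℬ)) (fun t i ht => ?_)
      (mem_countableUnions_of_mem (hf k))
    rw [sdiff_eq]
    exact inter_mem_countableUnions hinter ht (hcompl _ (hf i))
  refine ⟨fun i => ⋃ n, disjointed f (Nat.pair i n),
    fun i => iUnion_mem_countableUnions fun n => hdisj _, fun i => ?_, fun i j hij => ?_, ?_⟩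
  · rw [hCD i]
    refine iUnion_mono fun n => (disjointed_subset f _).trans ?_
    simp [f]
  · rw [← disjoint_iff_inter_eq_empty, disjoint_iUnion_left]
    intro n
    rw [disjoint_iUnion_right]
    intro m
    exact disjoint_disjointed f fun h => hij (Nat.pair_eq_pair.1 h).1
  · calc (⋃ i, ⋃ n, disjointed f (Nat.pair i n))
        = ⋃ k : ℕ, disjointed f (Nat.pair k.unpair.1 k.unpair.2) :=
          (iUnion_unpair fun i n => disjointed f (Nat.pair i n)).symm
      _ = ⋃ k, f k := by simp only [Nat.pair_unpair, iUnion_disjointed]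
      _ = ⋃ i, ⋃ n, D i n := iUnion_unpair D
      _ = ⋃ i, C i := (iUnion_congr hCD).symm

theorem SigmaO_one (X : Type) [TopologicalSpace X] : SigmaO X 1 = {U : Set X | IsOpen U} := by
  rw [SigmaO, if_pos rfl]

/-- The differences of open sets. -/
def openDiffs (X : Type) [TopologicalSpace X] : Set (Set X) :=
  {A | ∃ U V : Set X, IsOpen U ∧ IsOpen V ∧ A = U \ V}

/-- The complements of sets in `Σ⁰_β(X)` for some `1 ≤ β < α`. -/
def lowerPi (X : Type) [TopologicalSpace X] (α : Ordinal.{0}) : Set (Set X) :=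
  {A | ∃ β < α, 1 ≤ β ∧ Aᶜ ∈ SigmaO X β}

theorem SigmaO_two (X : Type) [TopologicalSpace X] :
    SigmaO X 2 = countableUnions (openDiffs X) := by
  have h : (2 : Ordinal.{0}) ≠ 1 := by norm_num
  rw [SigmaO, if_neg h, if_pos rfl]
  ext A
  constructor
  · rintro ⟨U, V, hU, hV, rfl⟩
    exact ⟨fun n => U n \ V n, fun n => ⟨_, _, hU n, hV n, rfl⟩, rfl⟩
  · rintro ⟨D, hD, rfl⟩
    choose U V hU hV hDUV using hD
    exact ⟨U, V, hU, hV, iUnion_congr hDUV⟩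

theorem SigmaO_of_two_lt (X : Type) [TopologicalSpace X] {α : Ordinal.{0}} (hα : 2 < α) :
    SigmaO X α = countableUnions (lowerPi X α) := by
  have h : α ≠ 1 := (lt_trans (by norm_num) hα).ne'
  rw [SigmaO, if_neg h, if_neg hα.ne']
  ext A
  constructor
  · rintro ⟨S, hS, rfl⟩
    refine ⟨fun n => (S n)ᶜ, fun n => ?_, rfl⟩
    obtain ⟨β, hβ, h1, hSβ⟩ := hS n
    exact ⟨β, hβ, h1, by rwa [compl_compl]⟩
  · rintro ⟨D, hD, rfl⟩
    refine ⟨fun n => (D n)ᶜ, fun n => ?_, by simp only [compl_compl]⟩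
    obtain ⟨β, hβ, h1, hDβ⟩ := hD n
    exact ⟨β, hβ, h1, hDβ⟩

theorem openDiffs_inter {X : Type} [TopologicalSpace X] :
    ∀ A ∈ openDiffs X, ∀ B ∈ openDiffs X, A ∩ B ∈ openDiffs X := by
  rintro _ ⟨U, V, hU, hV, rfl⟩ _ ⟨U', V', hU', hV', rfl⟩
  refine ⟨U ∩ U', V ∪ V', hU.inter hU', hV.union hV', ?_⟩
  ext x
  simp only [mem_inter_iff, mem_sdiff, mem_union]
  tauto

theorem openDiffs_compl {X : Type} [TopologicalSpace X] :
    ∀ A ∈ openDiffs X, Aᶜ ∈ countableUnions (openDiffs X) := by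
  rintro _ ⟨U, V, hU, hV, rfl⟩
  have h : (U \ V)ᶜ = (univ \ U) ∪ (V \ ∅) := by
    ext x
    simp only [mem_compl_iff, mem_sdiff, mem_union, mem_univ, mem_empty_iff_false]
    tauto
  rw [h]
  exact union_mem_countableUnions
    (mem_countableUnions_of_mem ⟨_, _, isOpen_univ, hU, rfl⟩)
    (mem_countableUnions_of_mem ⟨_, _, hV, isOpen_empty, rfl⟩)

theorem one_or_two_or_two_lt {α : Ordinal.{0}} (hα : 1 ≤ α) : α = 1 ∨ α = 2 ∨ 2 < α := by
  rcases hα.eq_or_lt with h | h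
  · exact Or.inl h.symm
  · have h2 : (2 : Ordinal.{0}) ≤ α := by
      rw [← one_add_one_eq_two, ← Order.succ_eq_add_one]
      exact Order.succ_le_of_lt h
    exact Or.inr (h2.eq_or_lt.imp Eq.symm id)

theorem isOpen_mem_SigmaO_two {X : Type} [TopologicalSpace X] {U : Set X} (hU : IsOpen U) :
    U ∈ SigmaO X 2 := by
  rw [SigmaO_two]
  exact mem_countableUnions_of_mem ⟨U, ∅, hU, isOpen_empty, sdiff_empty.symm⟩

theorem SigmaO_mono {X : Type} [TopologicalSpace X] {α β : Ordinal.{0}} (hα : 1 ≤ α)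
    (hαβ : α ≤ β) : SigmaO X α ⊆ SigmaO X β := by
  rcases hαβ.eq_or_lt with rfl | hlt
  · exact Subset.rfl
  intro A hA
  have of_two : ∀ {γ : Ordinal.{0}}, 2 < γ → SigmaO X 2 ⊆ SigmaO X γ := by
    intro γ hγ B hB
    rw [SigmaO_two] at hB
    obtain ⟨D, hD, rfl⟩ := hB
    rw [SigmaO_of_two_lt X hγ]
    refine ⟨D, fun n => ⟨2, hγ, by norm_num, ?_⟩, rfl⟩
    rw [SigmaO_two]
    exact openDiffs_compl _ (hD n)
  rcases one_or_two_or_two_lt hα with rfl | rfl | h2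
  · rw [SigmaO_one] at hA
    rcases one_or_two_or_two_lt hαβ with rfl | rfl | h2
    · exact absurd hlt (lt_irrefl _)
    · exact isOpen_mem_SigmaO_two hA
    · exact of_two h2 (isOpen_mem_SigmaO_two hA)
  · exact of_two hlt hA
  · rw [SigmaO_of_two_lt X h2] at hA
    rw [SigmaO_of_two_lt X (h2.trans hlt)]
    obtain ⟨D, hD, rfl⟩ := hA
    refine ⟨D, fun n => ?_, rfl⟩
    obtain ⟨γ, hγ, h1, hDγ⟩ := hD n
    exact ⟨γ, hγ.trans hlt, h1, hDγ⟩

theorem union_mem_SigmaO {X : Type} [TopologicalSpace X] {α : Ordinal.{0}} (hα : 1 ≤ α)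
    {A B : Set X} (hA : A ∈ SigmaO X α) (hB : B ∈ SigmaO X α) : A ∪ B ∈ SigmaO X α := by
  rcases one_or_two_or_two_lt hα with rfl | rfl | h2
  · rw [SigmaO_one] at *
    exact IsOpen.union hA hB
  · rw [SigmaO_two] at *
    exact union_mem_countableUnions hA hB
  · rw [SigmaO_of_two_lt X h2] at *
    exact union_mem_countableUnions hA hB

theorem lowerPi_inter {X : Type} [TopologicalSpace X] {α : Ordinal.{0}} :
    ∀ A ∈ lowerPi X α, ∀ B ∈ lowerPi X α, A ∩ B ∈ lowerPi X α := by
  rintro A ⟨β, hβ, hβ1, hA⟩ B ⟨γ, hγ, hγ1, hB⟩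
  refine ⟨max β γ, max_lt hβ hγ, le_max_of_le_left hβ1, ?_⟩
  rw [compl_inter]
  exact union_mem_SigmaO (le_max_of_le_left hβ1) (SigmaO_mono hβ1 (le_max_left _ _) hA)
    (SigmaO_mono hγ1 (le_max_right _ _) hB)

theorem sigmaReduction_SigmaO {X : Type} [TopologicalSpace X] {α : Ordinal.{0}} (hα : 2 ≤ α) :
    SigmaReduction (SigmaO X α) := by
  rcases hα.eq_or_lt with rfl | h2
  · rw [SigmaO_two]
    exact sigmaReduction_countableUnions openDiffs_inter openDiffs_compl
  · rw [SigmaO_of_two_lt X h2]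
    refine sigmaReduction_countableUnions lowerPi_inter ?_
    rintro A ⟨β, hβ, h1, hA⟩
    rw [← SigmaO_of_two_lt X h2]
    exact SigmaO_mono h1 hβ.le hA

theorem setOf_isOpen_eq_countableUnions {X : Type} [TopologicalSpace X]
    [SecondCountableTopology X] (hX : ZeroDim X) :
    {U : Set X | IsOpen U} = countableUnions {V : Set X | IsClopen V} := by
  ext U
  constructor
  · intro hU
    choose V hV hxV hVU using fun x : U => hX x U hU x.2
    obtain ⟨T, hT, hTU⟩ := TopologicalSpace.isOpen_iUnion_countable V fun x => (hV x).isOpen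
    have hUV : U = ⋃ x ∈ T, V x := by
      rw [hTU]
      exact Subset.antisymm (fun x hx => mem_iUnion.2 ⟨⟨x, hx⟩, hxV ⟨x, hx⟩⟩)
        (iUnion_subset hVU)
    rcases T.eq_empty_or_nonempty with rfl | hne
    · rw [hUV, biUnion_empty]
      exact mem_countableUnions_of_mem isClopen_empty
    · obtain ⟨g, rfl⟩ := hT.exists_eq_range hne
      exact ⟨fun n => V (g n), fun n => hV _, by rw [hUV, biUnion_range]⟩
  · rintro ⟨D, hD, rfl⟩
    exact isOpen_iUnion fun n => (hD n).isOpen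

theorem sigmaReduction_setOf_isOpen {X : Type} [TopologicalSpace X]
    [SecondCountableTopology X] (hX : ZeroDim X) : SigmaReduction {U : Set X | IsOpen U} := by
  rw [setOf_isOpen_eq_countableUnions hX]
  exact sigmaReduction_countableUnions (fun _ hA _ hB => IsClopen.inter hA hB)
    fun _ hA => mem_countableUnions_of_mem (IsClopen.compl hA)

/-- σ-reduction for Borel levels in second-countable `T₀` spaces: every level
`Σ⁰_{2+α}(X)` has the σ-reduction property, and in zero-dimensional spaces so does every
level `Σ⁰_{1+α}(X)`, in particular the open sets. -/
theorem statement8 (X : Type) [TopologicalSpace X] [SecondCountableTopology X] [T0Space X] :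
    (∀ α < w1, SigmaReduction (SigmaO X (2 + α))) ∧
    (ZeroDim X → ∀ α < w1, SigmaReduction (SigmaO X (1 + α))) ∧
    (ZeroDim X → SigmaReduction {U : Set X | IsOpen U}) := by
  refine ⟨fun α _ => sigmaReduction_SigmaO le_self_add, fun hX α _ => ?_,
    sigmaReduction_setOf_isOpen⟩
  rcases one_or_two_or_two_lt (le_self_add : (1 : Ordinal.{0}) ≤ 1 + α) with h | h | h
  · rw [h, SigmaO_one]
    exact sigmaReduction_setOf_isOpen hX
  · exact sigmaReduction_SigmaO h.ge
  · exact sigmaReduction_SigmaO h.le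

end

end IFHpaper
end

section
/- Let Q be a quasiorder in which x ≤_Q y holds only when x = y (an antichain). If u and v are terms with u ⊴ v, then 𝓛(X,u) ⊆ 𝓛(X,v) for every base 𝓛(X) in every set X. -/
open Set

namespace IFHpaper

noncomputable section

section Levels

variable {X Q : Type} {L : Ordinal.{0} → Set (Set X)} {D : Set X} {A : X → Q}

theorem mem_levelOn_const {q : Q} :
    A ∈ levelOn Q L D (.const q) ↔ ∀ x ∈ D, A x = q := by
  constructor
  · rintro ⟨F, hF⟩
    cases F
    simpa only [Determines] using hF
  · intro h
    exact ⟨.const q L D, by simpa only [Determines] using h⟩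

theorem mem_levelOn_s {a : CtbOrd} {u : Term Q} :
    A ∈ levelOn Q L D (.s a u) ↔ A ∈ levelOn Q (shiftL L (Ordinal.omega0 ^ a.1)) D u := by
  constructor
  · rintro ⟨F, hF⟩
    cases F with
    | s _ _ _ _ F => exact ⟨F, by simpa only [Determines] using hF⟩
  · rintro ⟨F, hF⟩
    exact ⟨.s a u L D F, by simpa only [Determines] using hF⟩

theorem mem_levelOn_Fc {q : Q} {us : ℕ → Term Q} :
    A ∈ levelOn Q L D (.Fc q us) ↔ ∃ U : ℕ → Set X, (∀ i, U i ∈ restrictL L D 0) ∧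
      (∀ x ∈ D \ ⋃ i, U i, A x = q) ∧ ∀ i, A ∈ levelOn Q L (U i) (us i) := by
  constructor
  · rintro ⟨F, hF⟩
    cases F with
    | Fc _ _ _ _ U hU fams =>
      simp only [Determines] at hF
      exact ⟨U, hU, hF.1, fun i => ⟨fams i, hF.2 i⟩⟩
  · rintro ⟨U, hU, h0, h⟩
    choose fams hfams using h
    refine ⟨.Fc q us L D U hU fams, ?_⟩
    simp only [Determines]
    exact ⟨h0, hfams⟩

theorem mem_levelOn_Fo {a : CtbOrd} {us : ℕ → Term Q} :
    A ∈ levelOn Q L D (.Fo a us) ↔ ∃ U : ℕ → Set X, (∀ i, U i ∈ restrictL L D 0) ∧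
      A ∈ levelOn Q (shiftL L (Ordinal.omega0 ^ a.1)) (D \ ⋃ i, U i) (us 0) ∧
      ∀ i, A ∈ levelOn Q L (U i) (us (i + 1)) := by
  constructor
  · rintro ⟨F, hF⟩
    cases F with
    | Fo _ _ _ _ U hU F0 fams =>
      simp only [Determines] at hF
      exact ⟨U, hU, ⟨F0, hF.1⟩, fun i => ⟨fams i, hF.2 i⟩⟩
  · rintro ⟨U, hU, ⟨F0, h0⟩, h⟩
    choose fams hfams using h
    refine ⟨.Fo a us L D U hU F0 fams, ?_⟩
    simp only [Determines]
    exact ⟨h0, hfams⟩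

theorem omega0_lt_w1 : Ordinal.omega0 < w1 := by
  rw [w1, ← Cardinal.ord_aleph0, Cardinal.ord_lt_ord]
  exact Cardinal.aleph0_lt_aleph_one

theorem w1_pos : 0 < w1 := Ordinal.omega0_pos.trans omega0_lt_w1

theorem opow_add_lt_w1 (a : CtbOrd) {β : Ordinal.{0}} (hβ : β < w1) :
    Ordinal.omega0 ^ a.1 + β < w1 :=
  Ordinal.isPrincipal_add_ord (Cardinal.aleph0_le_aleph 1)
    (Ordinal.isPrincipal_opow_ord (Cardinal.aleph0_le_aleph 1) omega0_lt_w1 a.2) hβ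

theorem shiftL_zero_mem (hL : IsBase L) (a : CtbOrd) {S : Set X} (hS : S ∈ L 0) :
    S ∈ shiftL L (Ordinal.omega0 ^ a.1) 0 ∧ Sᶜ ∈ shiftL L (Ordinal.omega0 ^ a.1) 0 := by
  refine hL.mono 0 _ ?_ (opow_add_lt_w1 a w1_pos) S hS
  rw [add_zero]
  exact Ordinal.opow_pos _ Ordinal.omega0_pos

theorem IsBase.shiftL (hL : IsBase L) (a : CtbOrd) :
    IsBase (shiftL L (Ordinal.omega0 ^ a.1)) where
  iUnion_mem α hα := hL.iUnion_mem _ (opow_add_lt_w1 a hα)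
  inter_mem α hα := hL.inter_mem _ (opow_add_lt_w1 a hα)
  empty_mem α hα := hL.empty_mem _ (opow_add_lt_w1 a hα)
  univ_mem α hα := hL.univ_mem _ (opow_add_lt_w1 a hα)
  mono α β hαβ hβ := hL.mono _ _ (by gcongr) (opow_add_lt_w1 a hβ)

theorem shiftL_shiftL_of_lt {a b : CtbOrd} (hab : a.1 < b.1) :
    shiftL (shiftL L (Ordinal.omega0 ^ a.1)) (Ordinal.omega0 ^ b.1) =
      shiftL L (Ordinal.omega0 ^ b.1) := by
  funext α
  have h : Ordinal.omega0 ^ a.1 + Ordinal.omega0 ^ b.1 = Ordinal.omega0 ^ b.1 :=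
    Ordinal.add_omega0_opow ((Ordinal.opow_lt_opow_iff_right Ordinal.one_lt_omega0).2 hab)
  simp only [shiftL, ← add_assoc, h]

theorem empty_mem_restrictL (hL : IsBase L) : ∅ ∈ restrictL L D 0 :=
  ⟨∅, hL.empty_mem 0 w1_pos, by simp⟩

theorem inter_mem_restrictL {E W : Set X} (hW : W ∈ restrictL L D 0) (hED : E ⊆ D) :
    E ∩ W ∈ restrictL L E 0 := by
  obtain ⟨S, hS, rfl⟩ := hW
  exact ⟨S, hS, by rw [← inter_assoc, inter_eq_left.2 hED]⟩

/-- Families restrict to arbitrary subdomains. -/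
theorem levelOn_mono {v : Term Q} {E : Set X} (hED : E ⊆ D) (h : A ∈ levelOn Q L D v) :
    A ∈ levelOn Q L E v := by
  induction v generalizing L D E with
  | const q =>
    rw [mem_levelOn_const] at h ⊢
    exact fun x hx => h x (hED hx)
  | s a u ih =>
    rw [mem_levelOn_s] at h ⊢
    exact ih hED h
  | Fc q us ih =>
    obtain ⟨U, hU, h0, h⟩ := mem_levelOn_Fc.1 h
    refine mem_levelOn_Fc.2 ⟨fun i => E ∩ U i, fun i => inter_mem_restrictL (hU i) hED,
      ?_, fun i => ?_⟩
    · rw [← inter_iUnion, sdiff_self_inter]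
      exact fun x hx => h0 x ⟨hED hx.1, hx.2⟩
    · exact ih i inter_subset_right (h i)
  | Fo a us ih =>
    obtain ⟨U, hU, h0, h⟩ := mem_levelOn_Fo.1 h
    refine mem_levelOn_Fo.2 ⟨fun i => E ∩ U i, fun i => inter_mem_restrictL (hU i) hED,
      ?_, fun i => ?_⟩
    · rw [← inter_iUnion, sdiff_self_inter]
      exact ih 0 (sdiff_subset_sdiff_left hED) h0
    · exact ih (i + 1) inter_subset_right (h i)

theorem mem_levelOn_empty (hL : IsBase L) (v : Term Q) : A ∈ levelOn Q L ∅ v := by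
  induction v generalizing L with
  | const q => simp [mem_levelOn_const]
  | s a u ih => exact mem_levelOn_s.2 (ih (hL.shiftL a))
  | Fc q us ih =>
    exact mem_levelOn_Fc.2 ⟨fun _ => ∅, fun _ => empty_mem_restrictL hL, by simp,
      fun i => ih i hL⟩
  | Fo a us ih =>
    refine mem_levelOn_Fo.2 ⟨fun _ => ∅, fun _ => empty_mem_restrictL hL, ?_,
      fun i => ih (i + 1) hL⟩
    rw [empty_sdiff]
    exact ih 0 (hL.shiftL a)

theorem iUnion_mem_restrictL {U : ℕ → Set X} (hL : IsBase L)
    (hU : ∀ i, U i ∈ restrictL L D 0) : ⋃ i, U i ∈ restrictL L D 0 := by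
  choose S hS hUS using hU
  exact ⟨⋃ i, S i, hL.iUnion_mem 0 w1_pos S hS, by simp only [hUS, inter_iUnion]⟩

theorem restrictL_trans {V W : Set X} (hL : IsBase L) (hV : V ∈ restrictL L D 0)
    (hW : W ∈ restrictL L V 0) : W ∈ restrictL L D 0 := by
  obtain ⟨S, hS, rfl⟩ := hV
  obtain ⟨S', hS', rfl⟩ := hW
  exact ⟨S ∩ S', hL.inter_mem 0 w1_pos _ _ hS hS', inter_assoc _ _ _⟩

theorem restrictL_of_subset {E W : Set X} (hW : W ∈ restrictL L D 0) (hWE : W ⊆ E)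
    (hED : E ⊆ D) : W ∈ restrictL L E 0 := by
  obtain ⟨S, hS, rfl⟩ := hW
  exact ⟨S, hS, subset_antisymm (subset_inter hWE inter_subset_right)
    (inter_subset_inter_left _ hED)⟩

theorem subset_of_mem_restrictL {W : Set X} (hW : W ∈ restrictL L D 0) : W ⊆ D := by
  obtain ⟨S, -, rfl⟩ := hW
  exact inter_subset_left

theorem restrictL_subset_shiftL (hL : IsBase L) (a : CtbOrd) {W : Set X}
    (hW : W ∈ restrictL L D 0) :
    W ∈ restrictL (shiftL L (Ordinal.omega0 ^ a.1)) D 0 ∧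
      D \ W ∈ restrictL (shiftL L (Ordinal.omega0 ^ a.1)) D 0 := by
  obtain ⟨S, hS, rfl⟩ := hW
  obtain ⟨h, h'⟩ := shiftL_zero_mem hL a hS
  exact ⟨⟨S, h, rfl⟩, ⟨Sᶜ, h', by rw [sdiff_self_inter, sdiff_eq]⟩⟩

/-- Families on the members of a countable cover by level-`0` sets glue, even when the cover
is not disjoint. -/
theorem levelOn_iUnion {v : Term Q} (hL : IsBase L) {W : ℕ → Set X}
    (hW : ∀ i, W i ∈ restrictL L D 0) (hD : D ⊆ ⋃ i, W i)
    (h : ∀ i, A ∈ levelOn Q L (W i) v) : A ∈ levelOn Q L D v := by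
  induction v generalizing L D W with
  | const q =>
    refine mem_levelOn_const.2 fun x hx => ?_
    obtain ⟨i, hi⟩ := mem_iUnion.1 (hD hx)
    exact mem_levelOn_const.1 (h i) x hi
  | s a u ih =>
    exact mem_levelOn_s.2 (ih (hL.shiftL a) (fun i => (restrictL_subset_shiftL hL a (hW i)).1)
      hD fun i => mem_levelOn_s.1 (h i))
  | Fc q us ih =>
    choose U hU h0 h using fun i => mem_levelOn_Fc.1 (h i)
    have hUD : ∀ i j, U i j ∈ restrictL L D 0 := fun i j => restrictL_trans hL (hW i) (hU i j)
    have hV : ∀ j, ⋃ i, U i j ∈ restrictL L D 0 := fun j =>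
      iUnion_mem_restrictL hL fun i => hUD i j
    refine mem_levelOn_Fc.2 ⟨fun j => ⋃ i, U i j, hV, fun x hx => ?_, fun j => ?_⟩
    · obtain ⟨i, hi⟩ := mem_iUnion.1 (hD hx.1)
      refine h0 i x ⟨hi, fun hx' => hx.2 ?_⟩
      obtain ⟨j, hj⟩ := mem_iUnion.1 hx'
      exact mem_iUnion.2 ⟨j, mem_iUnion.2 ⟨i, hj⟩⟩
    · exact ih j hL (fun i => restrictL_of_subset (hUD i j) (subset_iUnion (U · j) i)
        (subset_of_mem_restrictL (hV j))) subset_rfl fun i => h i j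
  | Fo a us ih =>
    choose U hU h0 h using fun i => mem_levelOn_Fo.1 (h i)
    have hUD : ∀ i j, U i j ∈ restrictL L D 0 := fun i j => restrictL_trans hL (hW i) (hU i j)
    have hV : ∀ j, ⋃ i, U i j ∈ restrictL L D 0 := fun j =>
      iUnion_mem_restrictL hL fun i => hUD i j
    refine mem_levelOn_Fo.2 ⟨fun j => ⋃ i, U i j, hV, ?_, fun j => ?_⟩
    · refine ih 0 (W := fun i => (D \ ⋃ j, ⋃ i, U i j) ∩ W i) (hL.shiftL a) (fun i =>
        inter_mem_restrictL (restrictL_subset_shiftL hL a (hW i)).1 sdiff_subset) ?_ fun i => ?_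
      · rw [← inter_iUnion]
        exact subset_inter subset_rfl (sdiff_subset.trans hD)
      · refine levelOn_mono (D := W i \ ⋃ j, U i j) (fun x hx => ⟨hx.2, fun hx' => hx.1.2 ?_⟩)
          (h0 i)
        obtain ⟨j, hj⟩ := mem_iUnion.1 hx'
        exact mem_iUnion.2 ⟨j, mem_iUnion.2 ⟨i, hj⟩⟩
    · exact ih (j + 1) hL (fun i => restrictL_of_subset (hUD i j) (subset_iUnion (U · j) i)
        (subset_of_mem_restrictL (hV j))) subset_rfl fun i => h i j

theorem levelOn_s_of_cover {b : CtbOrd} {v : Term Q} (hL : IsBase L) {U : ℕ → Set X}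
    (hU : ∀ i, U i ∈ restrictL L D 0) (h0 : A ∈ levelOn Q L (D \ ⋃ i, U i) (.s b v))
    (h : ∀ i, A ∈ levelOn Q L (U i) (.s b v)) : A ∈ levelOn Q L D (.s b v) := by
  refine mem_levelOn_s.2 (levelOn_iUnion (hL.shiftL b)
    (W := fun i => Nat.casesOn i (D \ ⋃ i, U i) U) ?_ ?_ ?_)
  · rintro (_ | i)
    · exact (restrictL_subset_shiftL hL b (iUnion_mem_restrictL hL hU)).2
    · exact (restrictL_subset_shiftL hL b (hU i)).1
  · intro x hx
    by_cases hx' : x ∈ ⋃ i, U i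
    · obtain ⟨i, hi⟩ := mem_iUnion.1 hx'
      exact mem_iUnion.2 ⟨i + 1, hi⟩
    · exact mem_iUnion.2 ⟨0, hx, hx'⟩
  · rintro (_ | i)
    · exact mem_levelOn_s.1 h0
    · exact mem_levelOn_s.1 (h i)

theorem levelOn_Fc_of_cover {r : Q} {vs : ℕ → Term Q} (hL : IsBase L) {U : ℕ → Set X}
    (hU : ∀ i, U i ∈ restrictL L D 0) (h0 : A ∈ levelOn Q L (D \ ⋃ i, U i) (.const r))
    (h : ∀ i, A ∈ levelOn Q L (U i) (.Fc r vs)) : A ∈ levelOn Q L D (.Fc r vs) := by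
  have hW := iUnion_mem_restrictL hL hU
  obtain ⟨V, hV, h0', h'⟩ := mem_levelOn_Fc.1 (levelOn_iUnion hL (fun i =>
    restrictL_of_subset (hU i) (subset_iUnion U i) (subset_of_mem_restrictL hW)) subset_rfl h)
  refine mem_levelOn_Fc.2 ⟨V, fun i => restrictL_trans hL hW (hV i), fun x hx => ?_, h'⟩
  by_cases hx' : x ∈ ⋃ i, U i
  · exact h0' x ⟨hx', hx.2⟩
  · exact mem_levelOn_const.1 h0 x ⟨hx.1, hx'⟩

theorem levelOn_Fo_of_cover {b : CtbOrd} {vs : ℕ → Term Q} (hL : IsBase L) {U : ℕ → Set X}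
    (hU : ∀ i, U i ∈ restrictL L D 0) (h0 : A ∈ levelOn Q L (D \ ⋃ i, U i) (.s b (vs 0)))
    (h : ∀ i, A ∈ levelOn Q L (U i) (.Fo b vs)) : A ∈ levelOn Q L D (.Fo b vs) := by
  have hW := iUnion_mem_restrictL hL hU
  obtain ⟨V, hV, h0', h'⟩ := mem_levelOn_Fo.1 (levelOn_iUnion hL (fun i =>
    restrictL_of_subset (hU i) (subset_iUnion U i) (subset_of_mem_restrictL hW)) subset_rfl h)
  refine mem_levelOn_Fo.2 ⟨V, fun i => restrictL_trans hL hW (hV i), ?_, h'⟩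
  refine mem_levelOn_s.1 (levelOn_s_of_cover hL
    (fun _ => inter_mem_restrictL hW sdiff_subset) (levelOn_mono ?_ h0)
    fun _ => levelOn_mono (D := (⋃ i, U i) \ ⋃ i, V i) ?_ (mem_levelOn_s.2 h0'))
  · rw [iUnion_const, sdiff_self_inter]
    exact sdiff_subset_sdiff_left sdiff_subset
  · exact fun x hx => ⟨hx.2, hx.1.2⟩

theorem levelOn_Fc_root {r : Q} {vs : ℕ → Term Q} (hL : IsBase L)
    (h : A ∈ levelOn Q L D (.const r)) : A ∈ levelOn Q L D (.Fc r vs) :=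
  levelOn_Fc_of_cover hL (fun _ => empty_mem_restrictL hL) (levelOn_mono sdiff_subset h)
    fun _ => mem_levelOn_empty hL _

theorem levelOn_Fo_root {b : CtbOrd} {vs : ℕ → Term Q} (hL : IsBase L)
    (h : A ∈ levelOn Q L D (.s b (vs 0))) : A ∈ levelOn Q L D (.Fo b vs) :=
  levelOn_Fo_of_cover hL (fun _ => empty_mem_restrictL hL) (levelOn_mono sdiff_subset h)
    fun _ => mem_levelOn_empty hL _

/-- The family of sets equal to `D` at index `i` and empty elsewhere. -/
theorem exists_cover_single (hL : IsBase L) {ws : ℕ → Term Q} (i : ℕ)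
    (h : A ∈ levelOn Q L D (ws i)) : ∃ U : ℕ → Set X, (∀ j, U j ∈ restrictL L D 0) ∧
      D \ ⋃ j, U j = ∅ ∧ ∀ j, A ∈ levelOn Q L (U j) (ws j) := by
  classical
  refine ⟨fun j => if j = i then D else ∅, fun j => ?_, ?_, fun j => ?_⟩
  · dsimp only
    split_ifs
    · exact ⟨univ, hL.univ_mem 0 w1_pos, (inter_univ D).symm⟩
    · exact empty_mem_restrictL hL
  · exact sdiff_eq_empty.2 fun x hx => mem_iUnion.2 ⟨i, by simpa using hx⟩
  · dsimp only
    split_ifs with hj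
    · exact hj ▸ h
    · exact mem_levelOn_empty hL _

theorem levelOn_Fc_child {r : Q} {vs : ℕ → Term Q} (hL : IsBase L) (i : ℕ)
    (h : A ∈ levelOn Q L D (vs i)) : A ∈ levelOn Q L D (.Fc r vs) := by
  obtain ⟨U, hU, hD, h⟩ := exists_cover_single hL i h
  exact mem_levelOn_Fc.2 ⟨U, hU, by simp [hD], h⟩

theorem levelOn_Fo_child {b : CtbOrd} {vs : ℕ → Term Q} (hL : IsBase L) (i : ℕ)
    (h : A ∈ levelOn Q L D (vs (i + 1))) : A ∈ levelOn Q L D (.Fo b vs) := by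
  obtain ⟨U, hU, hD, h⟩ := exists_cover_single hL (ws := fun j => vs (j + 1)) i h
  exact mem_levelOn_Fo.2 ⟨U, hU, hD ▸ mem_levelOn_empty (hL.shiftL b) _, h⟩

theorem levelOn_subset_of_TLE [Preorder Q] (hQ : ∀ x y : Q, x ≤ y → x = y) {u v : Term Q}
    (huv : TLE u v) (hL : IsBase L) (h : A ∈ levelOn Q L D u) : A ∈ levelOn Q L D v := by
  induction huv generalizing L D with
  | const_const hqr => rwa [← hQ _ _ hqr]
  | const_s _ ih =>
    exact mem_levelOn_s.2 (ih (hL.shiftL _) (mem_levelOn_const.2 (mem_levelOn_const.1 h)))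
  | const_Fc_left _ ih => exact levelOn_Fc_root hL (ih hL h)
  | const_Fc_right i _ ih => exact levelOn_Fc_child hL i (ih hL h)
  | const_Fo i _ ih =>
    cases i with
    | zero =>
      exact levelOn_Fo_root hL (mem_levelOn_s.2
        (ih (hL.shiftL _) (mem_levelOn_const.2 (mem_levelOn_const.1 h))))
    | succ i => exact levelOn_Fo_child hL i (ih hL h)
  | s_const _ ih =>
    exact mem_levelOn_const.2 (mem_levelOn_const.1 (ih (hL.shiftL _) (mem_levelOn_s.1 h)))
  | s_s_lt hab _ ih =>
    have := mem_levelOn_s.1 (ih (hL.shiftL _) (mem_levelOn_s.1 h))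
    rw [shiftL_shiftL_of_lt hab] at this
    exact mem_levelOn_s.2 this
  | s_s_eq _ ih => exact mem_levelOn_s.2 (ih (hL.shiftL _) (mem_levelOn_s.1 h))
  | s_s_gt hba _ ih =>
    refine mem_levelOn_s.2 (ih (hL.shiftL _) (mem_levelOn_s.2 ?_))
    rw [shiftL_shiftL_of_lt hba]
    exact mem_levelOn_s.1 h
  | s_Fc_left _ ih => exact levelOn_Fc_root hL (ih hL h)
  | s_Fc_right i _ ih => exact levelOn_Fc_child hL i (ih hL h)
  | s_Fo_left _ ih => exact levelOn_Fo_root hL (ih hL h)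
  | s_Fo_right i _ ih => exact levelOn_Fo_child hL i (ih hL h)
  | Fc_const _ _ ih0 ih =>
    obtain ⟨U, -, h0, h⟩ := mem_levelOn_Fc.1 h
    refine mem_levelOn_const.2 fun x hx => ?_
    by_cases hx' : x ∈ ⋃ i, U i
    · obtain ⟨i, hi⟩ := mem_iUnion.1 hx'
      exact mem_levelOn_const.1 (ih i hL (h i)) x hi
    · exact mem_levelOn_const.1 (ih0 hL (mem_levelOn_const.2 h0)) x ⟨hx, hx'⟩
  | Fc_s _ _ ih0 ih =>
    obtain ⟨U, hU, h0, h⟩ := mem_levelOn_Fc.1 h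
    exact levelOn_s_of_cover hL hU (ih0 hL (mem_levelOn_const.2 h0)) fun i => ih i hL (h i)
  | Fc_Fc_left _ _ ih0 ih =>
    obtain ⟨U, hU, h0, h⟩ := mem_levelOn_Fc.1 h
    exact levelOn_Fc_of_cover hL hU (ih0 hL (mem_levelOn_const.2 h0)) fun i => ih i hL (h i)
  | Fc_Fc_right i _ ih => exact levelOn_Fc_child hL i (ih hL h)
  | Fc_Fo_left _ _ ih0 ih =>
    obtain ⟨U, hU, h0, h⟩ := mem_levelOn_Fc.1 h
    exact levelOn_Fo_of_cover hL hU (ih0 hL (mem_levelOn_const.2 h0)) fun i => ih i hL (h i)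
  | Fc_Fo_right i _ ih => exact levelOn_Fo_child hL i (ih hL h)
  | Fo_const _ _ ih0 ih =>
    obtain ⟨U, -, h0, h⟩ := mem_levelOn_Fo.1 h
    refine mem_levelOn_const.2 fun x hx => ?_
    by_cases hx' : x ∈ ⋃ i, U i
    · obtain ⟨i, hi⟩ := mem_iUnion.1 hx'
      exact mem_levelOn_const.1 (ih i hL (h i)) x hi
    · exact mem_levelOn_const.1 (ih0 hL (mem_levelOn_s.2 h0)) x ⟨hx, hx'⟩
  | Fo_s _ _ ih0 ih =>
    obtain ⟨U, hU, h0, h⟩ := mem_levelOn_Fo.1 h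
    exact levelOn_s_of_cover hL hU (ih0 hL (mem_levelOn_s.2 h0)) fun i => ih i hL (h i)
  | Fo_Fc_left _ _ ih0 ih =>
    obtain ⟨U, hU, h0, h⟩ := mem_levelOn_Fo.1 h
    exact levelOn_Fc_of_cover hL hU (ih0 hL (mem_levelOn_s.2 h0)) fun i => ih i hL (h i)
  | Fo_Fc_right i _ ih => exact levelOn_Fc_child hL i (ih hL h)
  | Fo_Fo_left _ _ ih0 ih =>
    obtain ⟨U, hU, h0, h⟩ := mem_levelOn_Fo.1 h
    exact levelOn_Fo_of_cover hL hU (ih0 hL (mem_levelOn_s.2 h0)) fun i => ih i hL (h i)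
  | Fo_Fo_right i _ ih => exact levelOn_Fo_child hL i (ih hL h)

end Levels

/-- Theorem "inclus1": if `Q` is an antichain and `u ⊴ v`, then `𝓛(X,u) ⊆ 𝓛(X,v)` for
every base in every set. -/
theorem statement12 {Q : Type} [Preorder Q] (hQ : ∀ x y : Q, x ≤ y → x = y)
    (u v : Term Q) (huv : TLE u v) :
    ∀ (X : Type) (L : Ordinal.{0} → Set (Set X)), IsBase L →
      level Q L u ⊆ level Q L v :=
  fun _ _ hL _ hA => levelOn_subset_of_TLE hQ huv hL hA

end

end IFHpaper
end
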